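/- arXiv:1512.05864 — 12 statements merged into one kernel-verified Lean document; each statement's English description precedes it below -/
import Mathlib

section
/- Let l be a positive integer. If S is an optimal covering of l, then every element of S is at most 5. -/
/-- A multiset `S` of integers, each at least 2, is a covering of `l`
if the product of its elements is at least `l`. -/
def Covering (l : ℕ) (S : Multiset ℕ) : Prop :=
  (∀ x ∈ S, 2 ≤ x) ∧ l ≤ S.prod

/-- A covering of `l` is optimal if its cost (the sum of its elements) is
minimal among all coverings of `l`. -/
def OptimalCovering (l : ℕ) (S : Multiset ℕ) : Prop :=
  Covering l S ∧ ∀ T : Multiset ℕ, Covering l T → S.sum ≤ T.sum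

/-- Every element of an optimal covering of a positive integer `l` is at most 5. -/
theorem optimalCovering_elements_le_five
    (l : ℕ) (hl : 0 < l) (S : Multiset ℕ) (hS : OptimalCovering l S) :
    ∀ x ∈ S, x ≤ 5 := by
  obtain ⟨⟨htwo, hprod⟩, hmin⟩ := hS
  intro x hx
  by_contra! hlt
  -- Replacing `x ≥ 6` by `2` and `x - 3` lowers the cost but not the product.
  obtain ⟨R, rfl⟩ := Multiset.exists_cons_of_mem hx
  obtain ⟨y, rfl⟩ : ∃ y, x = y + 3 := ⟨x - 3, by omega⟩
  have hcov : Covering l (2 ::ₘ y ::ₘ R) := by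
    refine ⟨fun z hz => ?_, hprod.trans ?_⟩
    · simp only [Multiset.mem_cons] at hz
      rcases hz with rfl | rfl | hz
      · exact le_rfl
      · omega
      · exact htwo z (Multiset.mem_cons_of_mem hz)
    · simp only [Multiset.prod_cons, ← mul_assoc]
      exact Nat.mul_le_mul_right _ (by omega)
  have hcost := hmin _ hcov
  simp only [Multiset.sum_cons] at hcost
  omega
end

section
/- For every positive integer l there exists an optimal covering of l all of whose elements belong to {2, 3}. -/
/-- Every integer `n ≥ 2` is the sum of a multiset of twos and threes with product at least `n`. -/
theorem exists_two_three_sum_eq_le_prod (n : ℕ) (hn : 2 ≤ n) :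
    ∃ S : Multiset ℕ, (∀ x ∈ S, x = 2 ∨ x = 3) ∧ S.sum = n ∧ n ≤ S.prod := by
  induction n using Nat.strong_induction_on with
  | _ n ih =>
    obtain rfl | rfl | h4 : n = 2 ∨ n = 3 ∨ 4 ≤ n := by omega
    · exact ⟨{2}, by simp⟩
    · exact ⟨{3}, by simp⟩
    · obtain ⟨S, hS, hsum, hprod⟩ := ih (n - 2) (by omega) (by omega)
      refine ⟨2 ::ₘ S, by simpa using hS, ?_, ?_⟩
      · rw [Multiset.sum_cons]
        omega
      · rw [Multiset.prod_cons]
        omega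

/-- Every multiset of integers at least 2 can be replaced by a multiset of twos and threes with
the same sum and at least the same product. -/
theorem exists_two_three_sum_eq_prod_le (T : Multiset ℕ) (hT : ∀ x ∈ T, 2 ≤ x) :
    ∃ S : Multiset ℕ, (∀ x ∈ S, x = 2 ∨ x = 3) ∧ S.sum = T.sum ∧ T.prod ≤ S.prod := by
  induction T using Multiset.induction_on with
  | empty => exact ⟨0, by simp⟩
  | cons a T ih =>
    obtain ⟨A, hA, hAsum, hAprod⟩ :=
      exists_two_three_sum_eq_le_prod a (hT a (Multiset.mem_cons_self a T))
    obtain ⟨S, hS, hsum, hprod⟩ := ih fun x hx => hT x (Multiset.mem_cons_of_mem hx)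
    refine ⟨A + S, fun x hx => (Multiset.mem_add.mp hx).elim (hA x) (hS x), ?_, ?_⟩
    · rw [Multiset.sum_add, Multiset.sum_cons, hAsum, hsum]
    · rw [Multiset.prod_add, Multiset.prod_cons]
      exact Nat.mul_le_mul hAprod hprod

theorem exists_optimalCovering (l : ℕ) : ∃ T : Multiset ℕ, OptimalCovering l T := by
  classical
  have h : ∃ n, ∃ T : Multiset ℕ, Covering l T ∧ T.sum = n :=
    ⟨_, {l + 2}, by simp [Covering], rfl⟩
  obtain ⟨T, hT, hsum⟩ := Nat.find_spec h
  exact ⟨T, hT, fun U hU => hsum.trans_le (Nat.find_min' h ⟨U, hU, rfl⟩)⟩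

/-- For every positive integer `l` there exists an optimal covering of `l`
all of whose elements belong to `{2, 3}`. -/
theorem exists_optimalCovering_two_three (l : ℕ) (hl : 0 < l) :
    ∃ S : Multiset ℕ, OptimalCovering l S ∧ ∀ x ∈ S, x = 2 ∨ x = 3 := by
  obtain ⟨T, ⟨hT, hl⟩, hmin⟩ := exists_optimalCovering l
  obtain ⟨S, hS, hsum, hprod⟩ := exists_two_three_sum_eq_prod_le T hT
  refine ⟨S, ⟨⟨fun x hx => ?_, hl.trans hprod⟩, fun U hU => hsum.trans_le (hmin U hU)⟩, hS⟩
  have := hS x hx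
  omega
end

section
/- Let l ≥ 2 be an integer and let i be the least integer with 3^i ≥ l. If 2·3^i < 3l (i.e. l ≤ 3^i < 3l/2), then the multiset consisting of i copies of 3 is a covering of l, and every covering of l has cost at least 3i; that is, the minimal cost of a covering of l equals 3i. -/
/-- Three times an upper bound for the product of a multiset of naturals with sum `n`. -/
def threeMulMaxProd : ℕ → ℕ
  | 0 => 3
  | 1 => 4
  | 2 => 6
  | n + 3 => 3 * threeMulMaxProd n

theorem threeMulMaxProd_le_succ (n : ℕ) : threeMulMaxProd n ≤ threeMulMaxProd (n + 1) := by
  induction n using threeMulMaxProd.induct with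
  | case1 => simp [threeMulMaxProd]
  | case2 => simp [threeMulMaxProd]
  | case3 => simp [threeMulMaxProd]
  | case4 n ih =>
    rw [show n + 3 + 1 = (n + 1) + 3 by ring, threeMulMaxProd, threeMulMaxProd]
    lia

theorem two_mul_threeMulMaxProd_le (n : ℕ) :
    2 * threeMulMaxProd n ≤ threeMulMaxProd (n + 2) := by
  induction n using threeMulMaxProd.induct with
  | case1 => simp [threeMulMaxProd]
  | case2 => simp [threeMulMaxProd]
  | case3 => simp [threeMulMaxProd]
  | case4 n ih =>
    rw [show n + 3 + 2 = (n + 2) + 3 by ring, threeMulMaxProd, threeMulMaxProd]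
    lia

theorem mul_threeMulMaxProd_le (x n : ℕ) :
    x * threeMulMaxProd n ≤ threeMulMaxProd (n + x) := by
  induction x using Nat.strong_induction_on with
  | _ x ih =>
    match x, ih with
    | 0, _ => simp
    | 1, _ => simpa using threeMulMaxProd_le_succ n
    | 2, _ => exact two_mul_threeMulMaxProd_le n
    | 3, _ => simp [threeMulMaxProd]
    | 4, _ =>
      have h₁ := two_mul_threeMulMaxProd_le n
      have h₂ := two_mul_threeMulMaxProd_le (n + 2)
      rw [show n + 2 + 2 = n + 4 by ring] at h₂
      lia
    | y + 5, ih =>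
      have h := ih (y + 2) (by lia)
      rw [show n + (y + 5) = (n + (y + 2)) + 3 by ring, threeMulMaxProd]
      nlinarith [Nat.zero_le (y * threeMulMaxProd n)]

theorem three_mul_prod_le_threeMulMaxProd_sum (S : Multiset ℕ) :
    3 * S.prod ≤ threeMulMaxProd S.sum := by
  induction S using Multiset.induction_on with
  | empty => simp [threeMulMaxProd]
  | cons x S ih =>
    rw [Multiset.prod_cons, Multiset.sum_cons, add_comm]
    calc 3 * (x * S.prod) = x * (3 * S.prod) := by ring
      _ ≤ x * threeMulMaxProd S.sum := Nat.mul_le_mul_left x ih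
      _ ≤ _ := mul_threeMulMaxProd_le x S.sum

theorem threeMulMaxProd_three_mul_add_two (k : ℕ) :
    threeMulMaxProd (3 * k + 2) = 2 * 3 ^ (k + 1) := by
  induction k with
  | zero => simp [threeMulMaxProd]
  | succ k ih =>
    rw [show 3 * (k + 1) + 2 = (3 * k + 2) + 3 by ring, threeMulMaxProd, ih]
    ring

/-- If `i` is the least integer with `3^i ≥ l` and `3^i < 3l/2`, then `i` copies
of 3 form a covering of `l` and every covering of `l` has cost at least `3i`:
the minimal cost of a covering of `l` is `3i`. -/
theorem minimal_cost_case_ternary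
    (l i : ℕ) (hl : 2 ≤ l) (hi : l ≤ 3 ^ i) (hmin : ∀ j : ℕ, l ≤ 3 ^ j → i ≤ j)
    (hcase : 2 * 3 ^ i < 3 * l) :
    Covering l (Multiset.replicate i 3) ∧
      (∀ S : Multiset ℕ, Covering l S → 3 * i ≤ S.sum) := by
  refine ⟨⟨fun x hx => ?_, by simpa using hi⟩, fun S hS => ?_⟩
  · rw [Multiset.eq_of_mem_replicate hx]
    norm_num
  · by_contra! hlt
    obtain ⟨k, rfl⟩ : ∃ k, i = k + 1 := ⟨i - 1, by lia⟩
    have hmono := monotone_nat_of_le_succ threeMulMaxProd_le_succ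
      (show S.sum ≤ 3 * k + 2 by lia)
    rw [threeMulMaxProd_three_mul_add_two] at hmono
    have hprod := three_mul_prod_le_threeMulMaxProd_sum S
    have hcover := hS.2
    lia
end

section
/- Let l ≥ 2 be an integer and let i be the least integer with 3^i ≥ l. If 3l ≤ 2·3^i and 4·3^i < 9l (i.e. 3l/2 ≤ 3^i < 9l/4), then the multiset consisting of i−1 copies of 3 and one copy of 2 is a covering of l, and every covering of l has cost at least 3(i−1)+2 = 3i−1; that is, the minimal cost of a covering of l equals 3i−1. -/
/-- The largest product of a multiset of positive integers with sum `n`. -/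
def maxProd : ℕ → ℕ
  | 0 => 1
  | 1 => 1
  | 2 => 2
  | 3 => 3
  | 4 => 4
  | n + 5 => 3 * maxProd (n + 2)

theorem maxProd_step : ∀ n : ℕ, maxProd n ≤ maxProd (n + 1) ∧
    2 * maxProd n ≤ maxProd (n + 2) ∧ 3 * maxProd n ≤ maxProd (n + 3)
  | 0 => by simp [maxProd]
  | 1 => by simp [maxProd]
  | 2 => by simp [maxProd]
  | 3 => by simp [maxProd]
  | 4 => by simp [maxProd]
  | n + 5 => by
    obtain ⟨h₁, h₂, h₃⟩ := maxProd_step (n + 2)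
    refine ⟨?_, ?_, ?_⟩
    · change 3 * maxProd (n + 2) ≤ 3 * maxProd (n + 2 + 1)
      omega
    · change 2 * (3 * maxProd (n + 2)) ≤ 3 * maxProd (n + 2 + 2)
      omega
    · change 3 * (3 * maxProd (n + 2)) ≤ 3 * maxProd (n + 2 + 3)
      omega

theorem maxProd_mono : Monotone maxProd :=
  monotone_nat_of_le_succ fun n => (maxProd_step n).1

theorem mul_maxProd_le : ∀ x n : ℕ, x * maxProd n ≤ maxProd (n + x)
  | 0, n => by simp
  | 1, n => by simpa using (maxProd_step n).1
  | 2, n => (maxProd_step n).2.1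
  | 3, n => (maxProd_step n).2.2
  | x + 4, n => by
    have h₁ := mul_maxProd_le (x + 2) n
    have h₂ : 2 * maxProd (n + (x + 2)) ≤ maxProd (n + (x + 4)) :=
      (maxProd_step (n + (x + 2))).2.1
    nlinarith [Nat.zero_le (x * maxProd n)]

theorem Multiset.prod_le_maxProd_sum (S : Multiset ℕ) : S.prod ≤ maxProd S.sum := by
  induction S using Multiset.induction with
  | empty => simp [maxProd]
  | cons x S ih =>
    rw [Multiset.prod_cons, Multiset.sum_cons, add_comm]
    exact (Nat.mul_le_mul_left x ih).trans (mul_maxProd_le x S.sum)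

theorem maxProd_three_mul_add_four (k : ℕ) : maxProd (3 * k + 4) = 4 * 3 ^ k := by
  induction k with
  | zero => rfl
  | succ k ih =>
    change 3 * maxProd (3 * k + 4) = _
    rw [ih]
    ring

/-- If `i` is the least integer with `3^i ≥ l` and `3l/2 ≤ 3^i < 9l/4`, then
`i−1` copies of 3 together with one 2 form a covering of `l` and every covering
of `l` has cost at least `3i − 1`: the minimal cost of a covering of `l` is `3i − 1`. -/
theorem minimal_cost_case_one_two
    (l i : ℕ) (hl : 2 ≤ l) (hi : l ≤ 3 ^ i) (hmin : ∀ j : ℕ, l ≤ 3 ^ j → i ≤ j)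
    (hcase₁ : 3 * l ≤ 2 * 3 ^ i) (hcase₂ : 4 * 3 ^ i < 9 * l) :
    Covering l (Multiset.replicate (i - 1) 3 + {2}) ∧
      (∀ S : Multiset ℕ, Covering l S → 3 * i - 1 ≤ S.sum) := by
  obtain _ | i := i
  · simp at hi
    omega
  refine ⟨⟨?_, ?_⟩, ?_⟩
  · intro x hx
    rw [Multiset.mem_add, Multiset.mem_singleton] at hx
    rcases hx with hx | rfl
    · rw [Multiset.eq_of_mem_replicate hx]
      norm_num
    · exact le_rfl
  · rw [Multiset.prod_add, Multiset.prod_replicate, Multiset.prod_singleton, Nat.add_sub_cancel]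
    rw [pow_succ] at hcase₁
    omega
  · rintro S ⟨-, hS⟩
    by_contra! hlt
    have hprod := S.prod_le_maxProd_sum
    obtain _ | k := i
    · have := maxProd_mono (show S.sum ≤ 1 by omega)
      simp only [maxProd] at this
      omega
    · have := maxProd_mono (show S.sum ≤ 3 * k + 4 by omega)
      rw [maxProd_three_mul_add_four] at this
      rw [pow_succ, pow_succ] at hcase₂
      omega
end

section
/- Let l ≥ 2 be an integer and let i be the least integer with 3^i ≥ l. If 9l ≤ 4·3^i (i.e. 9l/4 ≤ 3^i < 3l), then the multiset consisting of i−2 copies of 3 and two copies of 2 is a covering of l, and every covering of l has cost at least 3(i−2)+4 = 3i−2; that is, the minimal cost of a covering of l equals 3i−2. -/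
/-- Every natural number satisfies `x ^ 3 ≤ 3 ^ x`. -/
lemma cube_le_three_pow (x : ℕ) : x ^ 3 ≤ 3 ^ x := by
  obtain hx | hx := Nat.lt_or_ge x 3
  · interval_cases x <;> norm_num
  · induction x, hx using Nat.le_induction with
    | base => norm_num
    | succ n hn ih =>
      have h : (n + 1) ^ 3 ≤ 3 * n ^ 3 := by
        nlinarith [Nat.mul_le_mul_right (n ^ 2) hn, Nat.mul_le_mul_right n hn]
      rw [pow_succ 3 n]
      lia

/-- The cube of the product of a multiset is at most `3` to the power of its sum. -/
lemma prod_cube_le_three_pow_sum (S : Multiset ℕ) : S.prod ^ 3 ≤ 3 ^ S.sum := by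
  induction S using Multiset.induction_on with
  | empty => simp
  | cons a S ih =>
    rw [Multiset.prod_cons, Multiset.sum_cons, mul_pow, pow_add]
    exact Nat.mul_le_mul (cube_le_three_pow a) ih

/-- If `i` is the least integer with `3^i ≥ l` and `9l/4 ≤ 3^i < 3l`, then
`i−2` copies of 3 together with two copies of 2 form a covering of `l` and every
covering of `l` has cost at least `3i − 2`: the minimal cost of a covering of `l`
is `3i − 2`. -/
theorem minimal_cost_case_two_twos
    (l i : ℕ) (hl : 2 ≤ l) (hi : l ≤ 3 ^ i) (hmin : ∀ j : ℕ, l ≤ 3 ^ j → i ≤ j)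
    (hcase : 9 * l ≤ 4 * 3 ^ i) :
    Covering l (Multiset.replicate (i - 2) 3 + Multiset.replicate 2 2) ∧
      (∀ S : Multiset ℕ, Covering l S → 3 * i - 2 ≤ S.sum) := by
  have hi2 : 2 ≤ i := by
    by_contra! h
    interval_cases i <;> lia
  refine ⟨⟨fun x hx => ?_, ?_⟩, fun S hS => ?_⟩
  · rcases Multiset.mem_add.1 hx with h | h <;> have := Multiset.eq_of_mem_replicate h <;> lia
  · obtain ⟨k, rfl⟩ := Nat.exists_eq_add_of_le' hi2
    rw [Multiset.prod_add, Multiset.prod_replicate, Multiset.prod_replicate,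
      Nat.add_sub_cancel]
    rw [pow_add] at hcase
    lia
  · by_contra! h
    have hcube : S.prod ^ 3 ≤ (3 ^ (i - 1)) ^ 3 := by
      rw [← pow_mul]
      exact (prod_cube_le_three_pow_sum S).trans (Nat.pow_le_pow_right (by norm_num) (by lia))
    have hprod : S.prod ≤ 3 ^ (i - 1) := (Nat.pow_le_pow_iff_left (by norm_num)).1 hcube
    have := hmin (i - 1) (hS.2.trans hprod)
    lia
end

section
/- Let l be a positive integer. If S is an optimal covering of l, then S contains at most one element equal to 5. -/
/-- An optimal covering of a positive integer `l` contains at most one element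
equal to 5. -/
theorem optimalCovering_count_five_le_one
    (l : ℕ) (hl : 0 < l) (S : Multiset ℕ) (hS : OptimalCovering l S) :
    S.count 5 ≤ 1 := by
  by_contra! h
  have hle : Multiset.replicate 2 5 ≤ S := Multiset.le_count_iff_replicate_le.mp h
  obtain ⟨R, rfl⟩ := Multiset.le_iff_exists_add.mp hle
  obtain ⟨⟨htwo, hprod⟩, hmin⟩ := hS
  have hcov : Covering l (Multiset.replicate 3 3 + R) := by
    refine ⟨fun x hx => ?_, ?_⟩
    · rcases Multiset.mem_add.mp hx with hx | hx
      · rw [Multiset.eq_of_mem_replicate hx]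
        norm_num
      · exact htwo x (Multiset.mem_add.mpr (Or.inr hx))
    · simp only [Multiset.prod_add, Multiset.prod_replicate] at hprod ⊢
      omega
  have hsum := hmin _ hcov
  simp only [Multiset.sum_add, Multiset.sum_replicate, smul_eq_mul] at hsum
  omega
end

section
/- Let l be a positive integer. If S is an optimal covering of l, then S contains at most six elements equal to 4. -/
/-- Replacing seven 4s by nine 3s in a covering yields a covering. -/
theorem Covering.replace_four_by_three {l : ℕ} {R : Multiset ℕ}
    (h : Covering l (Multiset.replicate 7 4 + R)) :
    Covering l (Multiset.replicate 9 3 + R) := by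
  obtain ⟨h_two, h_prod⟩ := h
  refine ⟨fun x hx => ?_, h_prod.trans ?_⟩
  · rcases Multiset.mem_add.mp hx with hx | hx
    · rw [Multiset.eq_of_mem_replicate hx]
      norm_num
    · exact h_two x (Multiset.mem_add.mpr (Or.inr hx))
  · rw [Multiset.prod_add, Multiset.prod_add, Multiset.prod_replicate, Multiset.prod_replicate]
    gcongr ?_ * _
    norm_num

/-- An optimal covering of a positive integer `l` contains at most six elements
equal to 4. -/
theorem optimalCovering_count_four_le_six
    (l : ℕ) (hl : 0 < l) (S : Multiset ℕ) (hS : OptimalCovering l S) :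
    S.count 4 ≤ 6 := by
  by_contra! h_count
  obtain ⟨R, rfl⟩ := Multiset.le_iff_exists_add.mp (Multiset.le_count_iff_replicate_le.mp h_count)
  have h_sum := hS.2 _ hS.1.replace_four_by_three
  simp only [Multiset.sum_add, Multiset.sum_replicate, smul_eq_mul] at h_sum
  omega
end

section
/- Let l ≥ 32 be an integer and let i be the least integer with 3^i ≥ l. Among all optimal coverings of l (all of whose elements lie in {2,3,4,5}), there is exactly one whose multiplicity vector (h5, h4, h3, h2) of elements 5, 4, 3, 2 is lexicographically greatest in the order: first h5 as large as possible, then h4, then h3. This unique vector is given by: (0,0,i,0) if l ≤ 3^i < 9l/8; (0,1,i−2,1) if 9l/8 ≤ 3^i < 81l/64; (0,3,i−4,0) if 81l/64 ≤ 3^i < 27l/20; (1,1,i−3,0) if 27l/20 ≤ 3^i < 3l/2; (0,0,i−1,1) if 3l/2 ≤ 3^i < 27l/16; (0,2,i−3,0) if 27l/16 ≤ 3^i < 9l/5; (1,0,i−2,0) if 9l/5 ≤ 3^i < 81l/40; (1,1,i−4,1) if 81l/40 ≤ 3^i < 9l/4; (0,1,i−2,0) if 9l/4 ≤ 3^i <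 81l/32; (0,2,i−4,1) if 81l/32 ≤ 3^i < 27l/10; (1,0,i−3,1) if 27l/10 ≤ 3^i < 3l. -/
/-- The multiplicity vector `(h5, h4, h3, h2)` of a multiset: the multiplicities
of the elements 5, 4, 3 and 2. -/
def mvec (S : Multiset ℕ) : ℕ × ℕ × ℕ × ℕ :=
  (S.count 5, S.count 4, S.count 3, S.count 2)

/-- Lexicographic comparison of multiplicity vectors `(h5, h4, h3, h2)`:
first compare `h5`, then `h4`, then `h3`. -/
def LexLe (a b : ℕ × ℕ × ℕ × ℕ) : Prop :=
  a.1 < b.1 ∨ (a.1 = b.1 ∧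
    (a.2.1 < b.2.1 ∨ (a.2.1 = b.2.1 ∧ a.2.2.1 ≤ b.2.2.1)))

/-- The multiplicity vector `(h5, h4, h3, h2)` prescribed by the case analysis of
the theorem, according to the position of `3^i` among the thresholds
`9l/8 < 81l/64 < 27l/20 < 3l/2 < 27l/16 < 9l/5 < 81l/40 < 9l/4 < 81l/32 < 27l/10 < 3l`
(inequalities between rationals written in integer form). -/
def targetVec (l i : ℕ) : ℕ × ℕ × ℕ × ℕ :=
  if 8 * 3 ^ i < 9 * l then (0, 0, i, 0)
  else if 64 * 3 ^ i < 81 * l then (0, 1, i - 2, 1)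
  else if 20 * 3 ^ i < 27 * l then (0, 3, i - 4, 0)
  else if 2 * 3 ^ i < 3 * l then (1, 1, i - 3, 0)
  else if 16 * 3 ^ i < 27 * l then (0, 0, i - 1, 1)
  else if 5 * 3 ^ i < 9 * l then (0, 2, i - 3, 0)
  else if 40 * 3 ^ i < 81 * l then (1, 0, i - 2, 0)
  else if 4 * 3 ^ i < 9 * l then (1, 1, i - 4, 1)
  else if 32 * 3 ^ i < 81 * l then (0, 1, i - 2, 0)
  else if 10 * 3 ^ i < 27 * l then (0, 2, i - 4, 1)
  else (1, 0, i - 3, 1)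

/-- Three times the largest product of a multiset of natural numbers with sum `n`
(for `n ≠ 1`, where it is a convenient upper bound). -/
def productBound : ℕ → ℕ
  | 0 => 3
  | 1 => 4
  | 2 => 6
  | n + 3 => 3 * productBound n

theorem productBound_three_mul (m r : ℕ) :
    productBound (3 * m + r) = 3 ^ m * productBound r := by
  induction m with
  | zero => simp
  | succ m ih =>
    rw [show 3 * (m + 1) + r = (3 * m + r) + 3 by ring, productBound, ih]
    ring

theorem productBound_le_succ (n : ℕ) : productBound n ≤ productBound (n + 1) := by
  fun_induction productBound n with
  | case1 => simp [productBound]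
  | case2 => simp [productBound]
  | case3 => simp [productBound]
  | case4 n ih =>
    rw [show n + 3 + 1 = (n + 1) + 3 by ring, productBound]
    omega

theorem productBound_mono : Monotone productBound :=
  monotone_nat_of_le_succ productBound_le_succ

theorem two_mul_productBound_le (n : ℕ) : 2 * productBound n ≤ productBound (n + 2) := by
  fun_induction productBound n with
  | case1 => simp [productBound]
  | case2 => simp [productBound]
  | case3 => simp [productBound]
  | case4 n ih =>
    rw [show n + 3 + 2 = (n + 2) + 3 by ring, productBound]
    omega

theorem four_mul_productBound_le (n : ℕ) : 4 * productBound n ≤ productBound (n + 4) := by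
  have h₁ := two_mul_productBound_le n
  have h₂ := two_mul_productBound_le (n + 2)
  rw [show n + 2 + 2 = n + 4 by ring] at h₂
  omega

theorem mul_productBound_le (x n : ℕ) : x * productBound n ≤ productBound (n + x) := by
  induction x using Nat.strong_induction_on with
  | _ x ih =>
    match x with
    | 0 => simp
    | 1 => simpa using productBound_le_succ n
    | 2 => exact two_mul_productBound_le n
    | 3 => simp [productBound]
    | 4 => exact four_mul_productBound_le n
    | y + 5 =>
      have h := ih (y + 2) (by omega)
      rw [show n + (y + 5) = (n + (y + 2)) + 3 by ring, productBound]
      nlinarith [Nat.zero_le (y * productBound n)]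

theorem three_mul_prod_le_productBound (T : Multiset ℕ) :
    3 * T.prod ≤ productBound T.sum := by
  induction T using Multiset.induction_on with
  | empty => simp [productBound]
  | cons x T ih =>
    rw [Multiset.prod_cons, Multiset.sum_cons, add_comm x]
    have h := mul_productBound_le x T.sum
    nlinarith [Nat.mul_le_mul_left x ih]

theorem exists_eq_replicate_add (T : Multiset ℕ) {x n : ℕ} (h : n ≤ T.count x) :
    ∃ R : Multiset ℕ, T = Multiset.replicate n x + R :=
  Multiset.le_iff_exists_add.mp (Multiset.le_count_iff_replicate_le.mp h)

/-- A multiset with at least `a` fives and `b` fours has its product bounded by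
`5 ^ a * 4 ^ b` times the largest product for the remaining sum; the sums are shifted
by `6` so that the remaining sum need not be expressed by a truncated subtraction. -/
theorem prod_le_of_le_count {T : Multiset ℕ} {a b n : ℕ} (ha : a ≤ T.count 5)
    (hb : b ≤ T.count 4) (hn : n + (5 * a + 4 * b) = T.sum + 6) :
    27 * T.prod ≤ 5 ^ a * 4 ^ b * productBound n := by
  obtain ⟨R, rfl⟩ := exists_eq_replicate_add T ha
  have hb' : b ≤ R.count 4 := by simpa [Multiset.count_replicate] using hb
  obtain ⟨R, rfl⟩ := exists_eq_replicate_add R hb'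
  have h := three_mul_prod_le_productBound R
  simp only [Multiset.sum_add, Multiset.sum_replicate, smul_eq_mul] at hn
  obtain rfl : n = 3 * 2 + R.sum := by omega
  rw [productBound_three_mul]
  simp only [Multiset.prod_add, Multiset.prod_replicate]
  nlinarith [Nat.mul_le_mul_left (5 ^ a * 4 ^ b) h]

theorem exists_eq_replicate_five_four_three_add (T : Multiset ℕ) :
    ∃ R : Multiset ℕ, T = Multiset.replicate (T.count 5) 5 + (Multiset.replicate (T.count 4) 4 +
      (Multiset.replicate (T.count 3) 3 + R)) := by
  obtain ⟨R, hR⟩ := exists_eq_replicate_add T le_rfl (x := 5)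
  have h4 : T.count 4 ≤ R.count 4 := by
    conv_lhs => rw [hR]
    simp [Multiset.count_replicate]
  obtain ⟨R', hR'⟩ := exists_eq_replicate_add R h4
  have h3 : T.count 3 ≤ R'.count 3 := by
    conv_lhs => rw [hR, hR']
    simp [Multiset.count_replicate]
  obtain ⟨R'', hR''⟩ := exists_eq_replicate_add R' h3
  exact ⟨R'', by rw [← hR'', ← hR', ← hR]⟩

theorem count_two_eq_of_sum_eq {R : Multiset ℕ} {d : ℕ} (hR : ∀ x ∈ R, 2 ≤ x) (hd : d ≤ 1)
    (hsum : R.sum = 2 * d) : R.count 2 = d := by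
  induction R using Multiset.induction_on with
  | empty =>
    simp only [Multiset.sum_zero] at hsum
    simp only [Multiset.count_zero]
    omega
  | cons x R _ =>
    have hx : 2 ≤ x := hR x (Multiset.mem_cons_self x R)
    rw [Multiset.sum_cons] at hsum
    obtain rfl : d = 1 := by omega
    obtain rfl : x = 2 := by omega
    have hR0 : R = 0 := by
      refine Multiset.eq_zero_of_forall_notMem fun y hy => ?_
      have h₁ := Multiset.le_sum_of_mem hy
      have h₂ := hR y (Multiset.mem_cons_of_mem hy)
      omega
    simp [hR0]

/-- Criterion for `(a, b, c, d)` to be the unique lexicographically greatest multiplicity vector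
of an optimal covering of `l`: it gives a covering, every smaller cost is too small, and neither
an additional `5`, nor an additional `4` with the same number of fives, is affordable. -/
theorem unique_lex_greatest_of_bounds {l : ℕ} (a b c d n₀ n₁ n₂ : ℕ) (hd : d ≤ 1)
    (hprod : l ≤ 5 ^ a * 4 ^ b * 3 ^ c * 2 ^ d)
    (hn₀ : n₀ + 1 = 5 * a + 4 * b + 3 * c + 2 * d)
    (hn₁ : n₁ + 5 * (a + 1) = 5 * a + 4 * b + 3 * c + 2 * d + 6)
    (hn₂ : n₂ + (5 * a + 4 * (b + 1)) = 5 * a + 4 * b + 3 * c + 2 * d + 6)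
    (h₀ : productBound n₀ < 3 * l)
    (h₁ : 5 ^ (a + 1) * productBound n₁ < 27 * l)
    (h₂ : 5 ^ a * 4 ^ (b + 1) * productBound n₂ < 27 * l) :
    ((∃ S : Multiset ℕ, OptimalCovering l S ∧ mvec S = (a, b, c, d)) ∧
      (∀ T : Multiset ℕ, OptimalCovering l T → LexLe (mvec T) (a, b, c, d))) ∧
    (∀ v : ℕ × ℕ × ℕ × ℕ,
      ((∃ S : Multiset ℕ, OptimalCovering l S ∧ mvec S = v) ∧
        (∀ T : Multiset ℕ, OptimalCovering l T → LexLe (mvec T) v)) →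
      v = (a, b, c, d)) := by
  set S : Multiset ℕ := Multiset.replicate a 5 + (Multiset.replicate b 4 +
    (Multiset.replicate c 3 + Multiset.replicate d 2)) with hS
  have hSsum : S.sum = 5 * a + 4 * b + 3 * c + 2 * d := by
    simp only [hS, Multiset.sum_add, Multiset.sum_replicate, smul_eq_mul]
    ring
  have hSprod : S.prod = 5 ^ a * 4 ^ b * 3 ^ c * 2 ^ d := by
    simp only [hS, Multiset.prod_add, Multiset.prod_replicate]
    ring
  have hSvec : mvec S = (a, b, c, d) := by
    simp [mvec, hS, Multiset.count_replicate]
  have hScov : Covering l S := by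
    refine ⟨fun x hx => ?_, hSprod ▸ hprod⟩
    simp only [hS, Multiset.mem_add, Multiset.mem_replicate] at hx
    omega
  have hSopt : OptimalCovering l S := by
    refine ⟨hScov, fun T hT => ?_⟩
    by_contra! hlt
    have h := three_mul_prod_le_productBound T
    have hmono : productBound T.sum ≤ productBound n₀ := productBound_mono (by omega)
    have := hT.2
    omega
  have hsum : ∀ T, OptimalCovering l T → T.sum = 5 * a + 4 * b + 3 * c + 2 * d :=
    fun T hT => hSsum ▸ le_antisymm (hT.2 S hScov) (hSopt.2 T hT.1)
  have hlex : ∀ T, OptimalCovering l T → LexLe (mvec T) (a, b, c, d) := by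
    intro T hT
    have hTsum := hsum T hT
    have hTl := hT.1.2
    have h5 : T.count 5 ≤ a := by
      by_contra! hlt
      have h := prod_le_of_le_count (a := a + 1) (b := 0) (n := n₁) hlt (Nat.zero_le _) (by omega)
      rw [pow_zero, mul_one] at h
      omega
    have h4 : T.count 5 = a → T.count 4 ≤ b := by
      intro heq
      by_contra! hlt
      have h := prod_le_of_le_count (b := b + 1) (n := n₂) heq.ge hlt (by omega)
      omega
    obtain ⟨R, hR⟩ := exists_eq_replicate_five_four_three_add T
    have h3 := congrArg Multiset.sum hR
    simp only [Multiset.sum_add, Multiset.sum_replicate, smul_eq_mul] at h3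
    simp only [LexLe, mvec]
    omega
  refine ⟨⟨⟨S, hSopt, hSvec⟩, hlex⟩, ?_⟩
  rintro v ⟨⟨T, hT, rfl⟩, hmax⟩
  have hle := hlex T hT
  have hge := hmax S hSopt
  rw [hSvec] at hge
  simp only [LexLe, mvec] at hle hge
  obtain ⟨h5, h4, h3⟩ : T.count 5 = a ∧ T.count 4 = b ∧ T.count 3 = c := by omega
  obtain ⟨R, hR⟩ := exists_eq_replicate_five_four_three_add T
  rw [h5, h4, h3] at hR
  have hRsum : R.sum = 2 * d := by
    have hTsum := hsum T hT
    rw [hR] at hTsum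
    simp only [Multiset.sum_add, Multiset.sum_replicate, smul_eq_mul] at hTsum
    omega
  have hR2 : ∀ x ∈ R, 2 ≤ x := fun x hx => hT.1.1 x (by rw [hR]; simp [hx])
  have h2 : T.count 2 = d := by
    rw [hR]
    simpa [Multiset.count_replicate] using count_two_eq_of_sum_eq hR2 hd hRsum
  simp [mvec, h5, h4, h3, h2]

/-- For `l ≥ 32` and `i` the least integer with `3^i ≥ l`, among the multiplicity
vectors of optimal coverings of `l` there is exactly one which is lexicographically
greatest (first `h5` as large as possible, then `h4`, then `h3`), and it is the
vector prescribed by the eleven-case analysis. -/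
theorem unique_lex_greatest_optimalCovering
    (l i : ℕ) (hl : 32 ≤ l) (hi : l ≤ 3 ^ i) (hmin : ∀ j : ℕ, l ≤ 3 ^ j → i ≤ j) :
    ((∃ S : Multiset ℕ, OptimalCovering l S ∧ mvec S = targetVec l i) ∧
      (∀ T : Multiset ℕ, OptimalCovering l T → LexLe (mvec T) (targetVec l i))) ∧
    (∀ v : ℕ × ℕ × ℕ × ℕ,
      ((∃ S : Multiset ℕ, OptimalCovering l S ∧ mvec S = v) ∧
        (∀ T : Multiset ℕ, OptimalCovering l T → LexLe (mvec T) v)) →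
      v = targetVec l i) := by
  have hi4 : 4 ≤ i := by
    by_contra! hlt
    have := Nat.pow_le_pow_right (n := 3) (by norm_num) (show i ≤ 3 by omega)
    omega
  obtain ⟨j, rfl⟩ := Nat.exists_eq_add_of_le' hi4
  have hprev : 3 ^ (j + 3) < l := by
    by_contra! hle
    have := hmin _ hle
    omega
  have hp (k : ℕ) : 3 ^ (j + k) = 3 ^ j * 3 ^ k := pow_add 3 j k
  generalize hv : targetVec l (j + 4) = v
  unfold targetVec at hv
  simp only [show j + 4 - 1 = j + 3 from rfl, show j + 4 - 2 = j + 2 from rfl,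
    show j + 4 - 3 = j + 1 from rfl, Nat.add_sub_cancel] at hv
  rw [hp] at hi hprev hv
  split_ifs at hv <;> subst hv
  · apply unique_lex_greatest_of_bounds 0 0 (j + 4) 0
      (3 * (j + 3) + 2) (3 * (j + 4) + 1) (3 * (j + 4) + 2) <;>
      (try simp only [productBound_three_mul, productBound, hp]) <;> omega
  · apply unique_lex_greatest_of_bounds 0 1 (j + 2) 1
      (3 * (j + 3) + 2) (3 * (j + 4) + 1) (3 * (j + 3) + 1) <;>
      (try simp only [productBound_three_mul, productBound, hp]) <;> omega
  · apply unique_lex_greatest_of_bounds 0 3 j 0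
      (3 * (j + 3) + 2) (3 * (j + 4) + 1) (3 * j + 2) <;>
      (try simp only [productBound_three_mul, productBound, hp]) <;> omega
  · apply unique_lex_greatest_of_bounds 1 1 (j + 1) 0
      (3 * (j + 3) + 2) (3 * (j + 2) + 2) (3 * (j + 1) + 2) <;>
      (try simp only [productBound_three_mul, productBound, hp]) <;> omega
  · apply unique_lex_greatest_of_bounds 0 0 (j + 3) 1
      (3 * (j + 3) + 1) (3 * (j + 4) + 0) (3 * (j + 4) + 1) <;>
      (try simp only [productBound_three_mul, productBound, hp]) <;> omega
  · apply unique_lex_greatest_of_bounds 0 2 (j + 1) 0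
      (3 * (j + 3) + 1) (3 * (j + 4) + 0) (3 * (j + 1) + 2) <;>
      (try simp only [productBound_three_mul, productBound, hp]) <;> omega
  · apply unique_lex_greatest_of_bounds 1 0 (j + 2) 0
      (3 * (j + 3) + 1) (3 * (j + 2) + 1) (3 * (j + 2) + 2) <;>
      (try simp only [productBound_three_mul, productBound, hp]) <;> omega
  · apply unique_lex_greatest_of_bounds 1 1 j 1
      (3 * (j + 3) + 1) (3 * (j + 2) + 1) (3 * (j + 1) + 1) <;>
      (try simp only [productBound_three_mul, productBound, hp]) <;> omega
  · apply unique_lex_greatest_of_bounds 0 1 (j + 2) 0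
      (3 * (j + 3) + 0) (3 * (j + 3) + 2) (3 * (j + 2) + 2) <;>
      (try simp only [productBound_three_mul, productBound, hp]) <;> omega
  · apply unique_lex_greatest_of_bounds 0 2 j 1
      (3 * (j + 3) + 0) (3 * (j + 3) + 2) (3 * (j + 1) + 1) <;>
      (try simp only [productBound_three_mul, productBound, hp]) <;> omega
  · apply unique_lex_greatest_of_bounds 1 0 (j + 1) 1
      (3 * (j + 3) + 0) (3 * (j + 2) + 0) (3 * (j + 2) + 1) <;>
      (try simp only [productBound_three_mul, productBound, hp]) <;> omega
end

section
/- Let l be a positive integer and let S be an optimal covering of l. If S is the disjoint union (multiset sum) of two multisets S₁ and S₂, then S₂ is an optimal covering of l' = ⌈l / P₁⌉, where P₁ is the product of the elements of S₁. In particular, the product of the elements of S₂ is at least ⌈l / P₁⌉, and every covering of ⌈l / P₁⌉ has cost at least the sum of the elements of S₂. -/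
/-- Ceiling division of natural numbers: `⌈a / b⌉`. -/
def ceilDiv (a b : ℕ) : ℕ := (a + b - 1) / b

theorem ceilDiv_le_iff {a b c : ℕ} (hb : 0 < b) : ceilDiv a b ≤ c ↔ a ≤ b * c := by
  rw [ceilDiv, ← Nat.ceilDiv_eq_add_pred_div, ceilDiv_le_iff_le_mul hb]

theorem covering_ceilDiv_prod_iff {l : ℕ} {S T : Multiset ℕ} (hS : ∀ x ∈ S, 2 ≤ x) :
    Covering (ceilDiv l S.prod) T ↔ Covering l (S + T) := by
  have hpos : 0 < S.prod := Multiset.prod_pos fun x hx => two_pos.trans_le (hS x hx)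
  simp only [Covering, ceilDiv_le_iff hpos, Multiset.prod_add, Multiset.mem_add]
  grind

/-- Local optimality: if `S = S₁ + S₂` is an optimal covering of `l`, then `S₂` is
an optimal covering of `⌈l / P₁⌉` where `P₁` is the product of the elements of `S₁`. -/
theorem optimalCovering_sub_multiset
    (l : ℕ) (hl : 0 < l) (S S₁ S₂ : Multiset ℕ)
    (hS : OptimalCovering l S) (hsplit : S = S₁ + S₂) :
    OptimalCovering (ceilDiv l S₁.prod) S₂ := by
  subst hsplit
  have hS₁ : ∀ x ∈ S₁, 2 ≤ x := fun x hx => hS.1.1 x (Multiset.mem_add.2 (Or.inl hx))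
  refine ⟨(covering_ceilDiv_prod_iff hS₁).2 hS.1, fun T hT => ?_⟩
  simpa using hS.2 _ ((covering_ceilDiv_prod_iff hS₁).1 hT)
end

section
/- For every positive integer l with l ≠ 16, one has ⌈l/5⌉ + ⌈l/15⌉ ≤ ⌈l/4⌉ + ⌈l/16⌉. -/
/-- For every positive integer `l ≠ 16`, `⌈l/5⌉ + ⌈l/15⌉ ≤ ⌈l/4⌉ + ⌈l/16⌉`. -/
theorem ceilDiv_five_fifteen_le (l : ℕ) (hl : 0 < l) (hl16 : l ≠ 16) :
    ceilDiv l 5 + ceilDiv l 15 ≤ ceilDiv l 4 + ceilDiv l 16 := by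
  unfold ceilDiv
  omega
end

section
/- Let l be a real number with l > 1. For every real h > 0, one has h · l^{1/h} ≥ e · ln l, with equality if and only if h = ln l. In other words, the function h ↦ h · l^{1/h} on (0, ∞) attains its global minimum value e · ln l exactly at h = ln l. -/
/-- For a real `l > 1`, the function `h ↦ h · l^(1/h)` on `(0, ∞)` attains its
global minimum value `e · ln l` exactly at `h = ln l`. -/
theorem min_of_ideal_running_time (l : ℝ) (hl : 1 < l) (h : ℝ) (hh : 0 < h) :
    Real.exp 1 * Real.log l ≤ h * l ^ (1 / h) ∧
      (h * l ^ (1 / h) = Real.exp 1 * Real.log l ↔ h = Real.log l) := by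
  obtain ⟨t, ht⟩ : ∃ t, Real.log l = h * t := ⟨Real.log l / h, by field_simp⟩
  have hpow : h * l ^ (1 / h) = h * Real.exp 1 * Real.exp (t - 1) := by
    rw [Real.rpow_def_of_pos (by linarith), ht, mul_assoc h (Real.exp 1), ← Real.exp_add]
    congr 2
    field_simp
    ring
  have hc : 0 < h * Real.exp 1 := by positivity
  have hlog : Real.exp 1 * Real.log l = h * Real.exp 1 * t := by rw [ht]; ring
  rw [hpow, hlog]
  refine ⟨mul_le_mul_of_nonneg_left (by linarith [Real.add_one_le_exp (t - 1)]) hc.le, ?_⟩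
  rw [mul_right_inj' hc.ne', ht, eq_comm (a := h), mul_eq_left₀ hh.ne']
  constructor
  · intro heq
    by_contra hne
    linarith [Real.add_one_lt_exp (sub_ne_zero.mpr hne)]
  · rintro rfl
    simp
end

section
/- For every integer l with l > 2^27, one has 3 · ⌈log₃ l⌉ < 2 · ⌈log₂ l⌉. -/
theorem exists_two_pow_le_three_pow (k : ℕ) (hk : 28 ≤ k) :
    ∃ m, 3 * m < 2 * k ∧ 2 ^ k ≤ 3 ^ m := by
  induction k using Nat.strong_induction_on with
  | _ k ih =>
    rcases Nat.lt_or_ge k 31 with h | h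
    · interval_cases k
      · exact ⟨18, by norm_num⟩
      · exact ⟨19, by norm_num⟩
      · exact ⟨19, by norm_num⟩
    · obtain ⟨j, rfl⟩ := Nat.exists_eq_add_of_le' (show 3 ≤ k by omega)
      obtain ⟨m, hm, hpow⟩ := ih j (by omega) (by omega)
      refine ⟨m + 2, by omega, ?_⟩
      rw [pow_add, pow_add]
      exact Nat.mul_le_mul hpow (by norm_num)

/-- For every integer `l > 2^27`, `3 · ⌈log₃ l⌉ < 2 · ⌈log₂ l⌉`: a perfect ternary
tree has strictly better parallel running time than a perfect binary tree. -/
theorem ternary_beats_binary (l : ℕ) (hl : 2 ^ 27 < l) :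
    3 * Nat.clog 3 l < 2 * Nat.clog 2 l := by
  obtain ⟨m, hm, hpow⟩ := exists_two_pow_le_three_pow (Nat.clog 2 l)
    ((Nat.lt_clog_iff_pow_lt one_lt_two).2 hl)
  have hclog : Nat.clog 3 l ≤ m :=
    Nat.clog_le_of_le_pow ((Nat.le_pow_clog one_lt_two l).trans hpow)
  omega
end
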